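/- arXiv:0707.0376 — 2 statements merged into one kernel-verified Lean document; each statement's English description precedes it below -/
import Mathlib

section
/- Assume Ω satisfies the p-Sobolev–Poincaré inequality with constant C₀ for some p with 1 < p ≤ n/(n−1). Then there is a constant C depending only on p and C₀ such that for every f ∈ W(Ω) and every median r_f of f and every t ∈ (0,1): ∫₀^t s^{1/p − 1} [ (f − r_f)**(s) − (f − r_f)*(s) ] ds ≤ C ∫₀^t |∇f|*(s) ds. -/
open MeasureTheory Set
open scoped ENNReal NNReal

noncomputable section

/-- The decreasing rearrangement of `u` with respect to the measure `μ`: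
`u*(t) = inf { λ ≥ 0 : μ{|u| > λ} ≤ t }`. -/
def decRearr {α : Type*} [MeasurableSpace α] (μ : Measure α) (u : α → ℝ) (t : ℝ) : ℝ :=
  sInf {l : ℝ | 0 ≤ l ∧ μ {x | l < |u x|} ≤ ENNReal.ofReal t}

/-- `u**(t) = (1/t) ∫₀ᵗ u*(s) ds`. -/
def decRearrAvg {α : Type*} [MeasurableSpace α] (μ : Measure α) (u : α → ℝ) (t : ℝ) : ℝ :=
  (1 / t) * ∫ s in Ioc (0 : ℝ) t, decRearr μ u s

abbrev Euc (n : ℕ) := EuclideanSpace ℝ (Fin n)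

/-- `|∇f|(x)`, using the a.e. defined differential (Rademacher's theorem for
locally Lipschitz functions). -/
def gradNorm {n : ℕ} (f : Euc n → ℝ) (x : Euc n) : ℝ := ‖fderiv ℝ f x‖

/-- The admissible class `W(Ω)`: locally Lipschitz on `Ω`, with `f` and `|∇f|`
integrable on `Ω`. -/
def MemW {n : ℕ} (Ω : Set (Euc n)) (f : Euc n → ℝ) : Prop :=
  (∀ x ∈ Ω, ∃ s ∈ nhds x, ∃ K : ℝ≥0, LipschitzOnWith K f s) ∧
    IntegrableOn f Ω ∧ IntegrableOn (gradNorm f) Ω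

/-- `Ω` satisfies the `p`-Sobolev–Poincaré inequality with constant `C₀`. -/
def SPIneq {n : ℕ} (Ω : Set (Euc n)) (p C₀ : ℝ) : Prop :=
  ∀ f : Euc n → ℝ, MemW Ω f →
    (∫ x in Ω, |f x - ∫ y in Ω, f y| ^ p) ^ (1 / p) ≤ C₀ * ∫ x in Ω, gradNorm f x

/-- `r` is a median of `f` on `Ω` (with `|Ω| = 1`). -/
def IsMedian {n : ℕ} (Ω : Set (Euc n)) (f : Euc n → ℝ) (r : ℝ) : Prop :=
  1 / 2 ≤ volume {x ∈ Ω | r ≤ f x} ∧ 1 / 2 ≤ volume {x ∈ Ω | f x ≤ r}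


def clampPhi (a b y : ℝ) : ℝ := max (min y b) a + min (max y (-b)) (-a)

lemma clampPhi_lip (a b : ℝ) : LipschitzWith 2 (clampPhi a b) := by
  have h1 : LipschitzWith 1 (fun y : ℝ => max (min y b) a) :=
    (LipschitzWith.id.min_const b).max_const a
  have h2 : LipschitzWith 1 (fun y : ℝ => min (max y (-b)) (-a)) :=
    (LipschitzWith.id.max_const (-b)).min_const (-a)
  have := h1.add h2
  norm_num at this
  exact this

lemma clampPhi_ge {a b y : ℝ} (hb : a < b) (h : b ≤ y) (ha : 0 < a) : clampPhi a b y = b - a := by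
  unfold clampPhi
  rw [min_eq_right h, max_eq_left hb.le, max_eq_left (by linarith), min_eq_right (by linarith)]; ring

lemma clampPhi_le {a b y : ℝ} (hb : a < b) (h : y ≤ -b) (ha : 0 < a) : clampPhi a b y = a - b := by
  unfold clampPhi
  rw [min_eq_left (by linarith), max_eq_right (by linarith), max_eq_right (by linarith),
    min_eq_left (by linarith)]; ring

lemma clampPhi_mid1 {a b y : ℝ} (ha : 0 < a) (h1 : a ≤ y) (h : y ≤ b) : clampPhi a b y = y - a := by
  unfold clampPhi
  rw [min_eq_left h, max_eq_left h1, max_eq_left (by linarith), min_eq_right (by linarith)]; ring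

lemma clampPhi_mid2 {a b y : ℝ} (ha : 0 < a) (h1 : -b ≤ y) (h : y ≤ -a) :
    clampPhi a b y = y + a := by
  unfold clampPhi
  rw [min_eq_left (by linarith), max_eq_right (by linarith), max_eq_left (by linarith),
    min_eq_left (by linarith)]; ring

lemma clampPhi_nonneg {a b y : ℝ} (hab : a < b) (h : -a ≤ y) : 0 ≤ clampPhi a b y := by
  unfold clampPhi
  rw [max_eq_left (by linarith : -b ≤ y), min_eq_right h]
  linarith [le_max_right (min y b) a]

lemma clampPhi_nonpos {a b y : ℝ} (hab : a < b) (h : y ≤ a) : clampPhi a b y ≤ 0 := by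
  unfold clampPhi
  rw [min_eq_left (by linarith : y ≤ b), max_eq_right h]
  linarith [min_le_right (max y (-b)) (-a)]

lemma clampPhi_ub {a b : ℝ} (y : ℝ) (hab : a < b) : clampPhi a b y ≤ b - a := by
  unfold clampPhi
  have := min_le_right (max y (-b)) (-a)
  have : max (min y b) a ≤ b := max_le (min_le_right _ _) hab.le
  linarith

lemma clampPhi_lb {a b : ℝ} (y : ℝ) (hab : a < b) : a - b ≤ clampPhi a b y := by
  unfold clampPhi
  have := le_max_right (min y b) a
  have : -b ≤ min (max y (-b)) (-a) := le_min (le_max_right _ _) (by linarith)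
  linarith

lemma gradNorm_clamp {n : ℕ} {f : Euc n → ℝ} {a b r : ℝ} (ha : 0 < a) (hab : a < b) {x : Euc n}
    (hf : ContinuousAt f x) :
    gradNorm (fun x => clampPhi a b (f x - r)) x
      = {x | a < |f x - r| ∧ |f x - r| < b}.indicator (gradNorm f) x := by
  have hc : ContinuousAt (fun x => f x - r) x := hf.sub continuousAt_const
  unfold gradNorm
  by_cases h : a < |f x - r| ∧ |f x - r| < b
  · rw [Set.indicator_of_mem (by exact h)]
    rcases le_total 0 (f x - r) with h0 | h0
    · rw [abs_of_nonneg h0] at h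
      have : (fun x => clampPhi a b (f x - r)) =ᶠ[nhds x] fun x => f x - (r + a) := by
        filter_upwards [hc.eventually (lt_mem_nhds h.1), hc.eventually (gt_mem_nhds h.2)] with y h1 h2
        rw [clampPhi_mid1 ha h1.le h2.le]; ring
      rw [this.fderiv_eq, fderiv_sub_const]
    · rw [abs_of_nonpos h0] at h
      have : (fun x => clampPhi a b (f x - r)) =ᶠ[nhds x] fun x => f x - (r - a) := by
        filter_upwards [hc.eventually (gt_mem_nhds (by linarith : f x - r < -a)),
          hc.eventually (lt_mem_nhds (by linarith : -b < f x - r))] with y h1 h2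
        rw [clampPhi_mid2 ha h2.le h1.le]; ring
      rw [this.fderiv_eq, fderiv_sub_const]
  · rw [Set.indicator_of_notMem (by exact h)]
    rw [norm_eq_zero]
    by_cases h1 : a < |f x - r|
    · have h2 : b ≤ |f x - r| := by
        by_contra h3; exact h ⟨h1, not_le.1 h3⟩
      rcases le_total 0 (f x - r) with h0 | h0
      · rw [abs_of_nonneg h0] at h2
        apply IsLocalMax.fderiv_eq_zero
        refine Filter.Eventually.of_forall fun y => ?_
        simp only [clampPhi_ge hab h2 ha]
        exact clampPhi_ub _ hab
      · rw [abs_of_nonpos h0] at h2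
        apply IsLocalMin.fderiv_eq_zero
        refine Filter.Eventually.of_forall fun y => ?_
        simp only [clampPhi_le hab (by linarith : f x - r ≤ -b) ha]
        exact clampPhi_lb _ hab
    · have h1' := abs_le.1 (not_lt.1 h1)
      have hz : clampPhi a b (f x - r) = 0 :=
        le_antisymm (clampPhi_nonpos hab h1'.2) (clampPhi_nonneg hab h1'.1)
      by_cases h3 : -a < f x - r
      · apply IsLocalMin.fderiv_eq_zero
        filter_upwards [hc.eventually (lt_mem_nhds h3)] with y hy
        simp only [hz]
        exact clampPhi_nonneg hab hy.le
      · apply IsLocalMax.fderiv_eq_zero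
        filter_upwards [hc.eventually (gt_mem_nhds (by linarith : f x - r < a))] with y hy
        simp only [hz]
        exact clampPhi_nonpos hab hy.le

lemma core_real {n : ℕ} {Ω : Set (Euc n)} {p C₀ : ℝ} (hp : 1 < p)
    (hΩ : IsOpen Ω) (hvol : volume Ω = 1) (hSP : SPIneq Ω p C₀)
    {f : Euc n → ℝ} (hf : MemW Ω f) {r : ℝ} (hr : IsMedian Ω f r)
    {a b : ℝ} (ha : 0 < a) (hab : a < b) :
    (b - a) * ((volume.restrict Ω).real {x | b < |f x - r|}) ^ (1 / p)
      ≤ 4 * C₀ * ∫ x in Ω ∩ {x | a < |f x - r| ∧ |f x - r| < b}, gradNorm f x := by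
  have hprob : IsProbabilityMeasure (volume.restrict Ω) := ⟨by simp [hvol]⟩
  have hcont : ∀ x ∈ Ω, ContinuousAt f x := by
    intro x hx
    obtain ⟨s, hs, K, hK⟩ := hf.1 x hx
    exact hK.continuousOn.continuousAt hs
  have hcontOn : ContinuousOn f Ω := fun x hx => (hcont x hx).continuousWithinAt
  set A := {x | a < |f x - r| ∧ |f x - r| < b} with hA
  have hAo : IsOpen (Ω ∩ A) := by
    have : ContinuousOn (fun x => |f x - r|) Ω := (hcontOn.sub continuousOn_const).abs
    exact this.isOpen_inter_preimage hΩ isOpen_Ioo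
  set H : Euc n → ℝ := fun x => clampPhi a b (f x - r) with hH
  have hHm : AEStronglyMeasurable H (volume.restrict Ω) := by
    refine ContinuousOn.aestronglyMeasurable ?_ hΩ.measurableSet
    exact (clampPhi_lip a b).continuous.comp_continuousOn (hcontOn.sub continuousOn_const)
  have hHb : ∀ x, |H x| ≤ b - a := fun x =>
    abs_le.2 ⟨by linarith [clampPhi_lb (f x - r) hab], clampPhi_ub _ hab⟩
  have hgr : EqOn (gradNorm H) ((Ω ∩ A).indicator (gradNorm f)) Ω := by
    intro x hx
    rw [hH, gradNorm_clamp ha hab (hcont x hx)]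
    by_cases h : x ∈ A
    · rw [indicator_of_mem h, indicator_of_mem (show x ∈ Ω ∩ A from ⟨hx, h⟩)]
    · rw [indicator_of_notMem h, indicator_of_notMem (fun h' => h h'.2)]
  have hHW : MemW Ω H := by
    refine ⟨fun x hx => ?_, ?_, ?_⟩
    · obtain ⟨s, hs, K, hK⟩ := hf.1 x hx
      refine ⟨s, hs, 2 * K, ?_⟩
      have h2 : LipschitzOnWith K (fun x => f x - r) s := by
        intro y hy z hz
        simpa [edist_sub_right] using hK hy hz
      exact (clampPhi_lip a b).comp_lipschitzOnWith h2
    · exact Integrable.of_bound hHm (b - a) (Filter.Eventually.of_forall hHb)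
    · refine IntegrableOn.congr_fun ?_ hgr.symm hΩ.measurableSet
      exact hf.2.2.indicator hAo.measurableSet
  have hint : ∫ x in Ω, gradNorm H x = ∫ x in Ω ∩ A, gradNorm f x := by
    rw [setIntegral_congr_fun hΩ.measurableSet hgr, setIntegral_indicator hAo.measurableSet]
    congr 2
    ext x; simp
  have key := hSP H hHW
  rw [hint] at key
  set c := ∫ y in Ω, H y with hc
  set F : Euc n → ℝ := fun x => |H x - c| ^ p with hF
  have hFi : Integrable F (volume.restrict Ω) := by
    refine Integrable.of_bound (C := (b - a + |c|) ^ p) ?_ (Filter.Eventually.of_forall fun x => ?_)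
    · have : Continuous fun y : ℝ => |y - c| ^ p :=
        (continuous_id.sub continuous_const).abs.rpow_const (fun _ => Or.inr (by linarith))
      exact this.comp_aestronglyMeasurable hHm
    · rw [Real.norm_of_nonneg (by positivity)]
      apply Real.rpow_le_rpow (abs_nonneg _) _ (by linarith)
      exact (abs_sub _ _).trans (by linarith [hHb x])
  have hmk := mul_meas_ge_le_integral_of_nonneg
    (Filter.Eventually.of_forall (fun x => by positivity : ∀ x, 0 ≤ F x)) hFi (((b - a) / 2) ^ p)
  have hFge : ∀ x, (b - a) / 2 ≤ |H x - c| → ((b - a) / 2) ^ p ≤ F x := fun x hx =>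
    Real.rpow_le_rpow (by linarith) hx (by linarith)
  set m := (volume.restrict Ω).real {x | b < |f x - r|} with hm
  have hm0 : 0 ≤ m := measureReal_nonneg
  have hm1 : m ≤ 1 := measureReal_le_one
  have half : ∀ (S : Set (Euc n)), 1 / 2 ≤ volume {x ∈ Ω | x ∈ S} →
      1 / 2 ≤ (volume.restrict Ω).real S := by
    intro S hS
    have : (1 / 2 : ℝ≥0∞) ≤ volume.restrict Ω S := by
      refine hS.trans (le_trans (measure_mono ?_) (Measure.le_restrict_apply Ω S))
      rintro x ⟨h1, h2⟩; exact ⟨h2, h1⟩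
    have := ENNReal.toReal_mono (measure_ne_top _ _) this
    simpa [Measure.real] using this
  have hmeas : m / 2 ≤ (volume.restrict Ω).real {x | ((b - a) / 2) ^ p ≤ F x} := by
    rcases le_or_gt ((b - a) / 2) c with h1 | h1
    · have := half {x | f x ≤ r} hr.2
      refine le_trans (le_trans (by linarith) this) (measureReal_mono fun x hx => hFge x ?_)
      have := clampPhi_nonpos hab (by simp at hx; linarith : f x - r ≤ a)
      rw [abs_sub_comm]
      refine le_trans ?_ (le_abs_self _)
      simp only [hH]; linarith
    · rcases le_or_gt c (-((b - a) / 2)) with h2 | h2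
      · have := half {x | r ≤ f x} hr.1
        refine le_trans (le_trans (by linarith) this) (measureReal_mono fun x hx => hFge x ?_)
        have := clampPhi_nonneg hab (by simp at hx; linarith : -a ≤ f x - r)
        refine le_trans ?_ (le_abs_self _)
        simp only [hH]; linarith
      · refine le_trans (by linarith : m / 2 ≤ m) (measureReal_mono fun x hx => hFge x ?_)
        rcases lt_abs.1 (show b < |f x - r| from hx) with h3 | h3
        · have := clampPhi_ge hab h3.le ha
          refine le_trans ?_ (le_abs_self _)
          simp only [hH]; linarith
        · have := clampPhi_le hab (by linarith : f x - r ≤ -b) ha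
          rw [abs_sub_comm]
          refine le_trans ?_ (le_abs_self _)
          simp only [hH]; linarith
  have hba : 0 ≤ (b - a) / 2 := by linarith
  have h3 : ((b - a) / 2) ^ p * (m / 2) ≤ ∫ x in Ω, F x :=
    le_trans (mul_le_mul_of_nonneg_left hmeas (by positivity)) hmk
  have h4 := Real.rpow_le_rpow (by positivity) h3 (by positivity : 0 ≤ 1 / p)
  rw [Real.mul_rpow (by positivity) (by positivity), ← Real.rpow_mul hba,
    mul_one_div_cancel (by linarith), Real.rpow_one, Real.div_rpow hm0 (by norm_num)] at h4
  have h5 : (2 : ℝ) ^ (1 / p) ≤ 2 := by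
    calc (2 : ℝ) ^ (1 / p) ≤ 2 ^ (1 : ℝ) :=
          Real.rpow_le_rpow_of_exponent_le (by norm_num) (by rw [div_le_one] <;> linarith)
      _ = 2 := by simp
  have h6 : m ^ (1 / p) / 2 ≤ m ^ (1 / p) / 2 ^ (1 / p) :=
    div_le_div_of_nonneg_left (by positivity) (by positivity) h5
  have h7 : (b - a) / 2 * (m ^ (1 / p) / 2) ≤ C₀ * ∫ x in Ω ∩ A, gradNorm f x :=
    (mul_le_mul_of_nonneg_left h6 hba).trans (h4.trans key)
  linarith

section rearr
variable {α : Type*} [MeasurableSpace α] {μ : Measure α} {u : α → ℝ}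

lemma decRearr_nonneg (s : ℝ) : 0 ≤ decRearr μ u s := Real.sInf_nonneg fun _ h => h.1

lemma decRearr_set_nonempty (hu : Integrable u μ) {s : ℝ} (hs : 0 < s) :
    {l : ℝ | 0 ≤ l ∧ μ {x | l < |u x|} ≤ ENNReal.ofReal s}.Nonempty := by
  have hI : 0 ≤ ∫ x, |u x| ∂μ := integral_nonneg fun _ => abs_nonneg _
  set I := ∫ x, |u x| ∂μ with hIdef
  have hlpos : 0 < I / s + 1 := by positivity
  refine ⟨I / s + 1, hlpos.le, ?_⟩
  have h := meas_ge_le_lintegral_div (μ := μ) (f := fun x => ENNReal.ofReal |u x|)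
    (hu.abs.aestronglyMeasurable.aemeasurable.ennreal_ofReal) (ε := ENNReal.ofReal (I / s + 1))
    (by simpa using hlpos) ENNReal.ofReal_ne_top
  rw [← ofReal_integral_eq_lintegral_ofReal hu.abs (Filter.Eventually.of_forall fun _ => abs_nonneg _),
    ← ENNReal.ofReal_div_of_pos hlpos] at h
  refine le_trans (measure_mono fun x hx => ?_) (h.trans (ENNReal.ofReal_le_ofReal ?_))
  · exact ENNReal.ofReal_le_ofReal (le_of_lt hx)
  · rw [div_le_iff₀ hlpos]
    have : s * (I / s + 1) = I + s := by field_simp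
    rw [← hIdef]; linarith

lemma decRearr_le {l s : ℝ} (hl : 0 ≤ l) (h : μ {x | l < |u x|} ≤ ENNReal.ofReal s) :
    decRearr μ u s ≤ l := csInf_le ⟨0, fun _ h => h.1⟩ ⟨hl, h⟩

lemma le_of_decRearr_lt (hu : Integrable u μ) {l s : ℝ} (hs : 0 < s) (h : decRearr μ u s < l) :
    μ {x | l < |u x|} ≤ ENNReal.ofReal s := by
  obtain ⟨k, hk, hkl⟩ := exists_lt_of_csInf_lt (decRearr_set_nonempty hu hs) h
  exact (measure_mono fun x hx => hkl.trans hx).trans hk.2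

lemma decRearr_anti (hu : Integrable u μ) : AntitoneOn (decRearr μ u) (Ioi 0) := by
  intro s hs t ht hst
  exact csInf_le_csInf ⟨0, fun _ h => h.1⟩ (decRearr_set_nonempty hu hs)
    fun l hl => ⟨hl.1, hl.2.trans (ENNReal.ofReal_le_ofReal hst)⟩

lemma decRearr_aemeas (hu : Integrable u μ) (t : ℝ) :
    AEMeasurable (decRearr μ u) (volume.restrict (Ioc 0 t)) :=
  aemeasurable_restrict_of_antitoneOn measurableSet_Ioc
    ((decRearr_anti hu).mono fun _ h => h.1)

lemma lint_upper (hu : Integrable u μ) (t : ℝ) :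
    ∫⁻ s in Ioc 0 t, ENNReal.ofReal (decRearr μ u s)
      ≤ ∫⁻ l in Ioi 0, min (μ {x | l < |u x|}) (ENNReal.ofReal t) := by
  rw [lintegral_eq_lintegral_meas_lt _ (Filter.Eventually.of_forall fun _ => decRearr_nonneg _)
    (decRearr_aemeas hu t)]
  refine setLIntegral_mono' measurableSet_Ioi fun l hl => ?_
  rw [Measure.restrict_apply' measurableSet_Ioc]
  refine le_min ?_ ?_
  · by_cases htop : μ {x | l < |u x|} = ∞
    · simp [htop]
    · calc _ ≤ volume (Ioc 0 (μ {x | l < |u x|}).toReal) := by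
            refine measure_mono ?_
            rintro s ⟨hs1, hs2⟩
            refine ⟨hs2.1, ?_⟩
            by_contra hc
            have : decRearr μ u s ≤ l := decRearr_le (le_of_lt hl) (by
              rw [← ENNReal.ofReal_toReal htop]
              exact ENNReal.ofReal_le_ofReal (not_le.1 hc).le)
            exact absurd hs1 (not_lt.2 this)
        _ = _ := by simp [ENNReal.ofReal_toReal htop]
  · refine (measure_mono inter_subset_right).trans ?_
    simp

lemma lint_lower (hu : Integrable u μ) {t : ℝ} :
    ∫⁻ l in Ioi 0, min (μ {x | l < |u x|}) (ENNReal.ofReal t) ≤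
    ∫⁻ s in Ioc 0 t, ENNReal.ofReal (decRearr μ u s) := by
  rw [lintegral_eq_lintegral_meas_le _ (Filter.Eventually.of_forall fun _ => decRearr_nonneg _)
    (decRearr_aemeas hu t)]
  refine setLIntegral_mono' measurableSet_Ioi fun l hl => ?_
  rw [Measure.restrict_apply' measurableSet_Ioc]
  set M := min (μ {x | l < |u x|}) (ENNReal.ofReal t) with hM
  have hMt : M ≠ ∞ := ne_top_of_le_ne_top ENNReal.ofReal_ne_top (min_le_right _ _)
  calc M = volume (Ioo 0 M.toReal) := by simp [ENNReal.ofReal_toReal hMt]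
    _ ≤ _ := by
      refine measure_mono ?_
      rintro s ⟨h1, h2⟩
      have h3 : ENNReal.ofReal s < M := by
        rw [← ENNReal.ofReal_toReal hMt]
        exact (ENNReal.ofReal_lt_ofReal_iff (h1.trans h2)).2 h2
      refine ⟨?_, h1, ?_⟩
      · by_contra hc
        have := le_of_decRearr_lt hu h1 (not_le.1 hc)
        exact absurd (h3.trans_le (min_le_left _ _)) (not_lt.2 this)
      · exact (ENNReal.ofReal_lt_ofReal_iff'.1 (h3.trans_le (min_le_right _ _))).1.le

lemma lint_fin (hu : Integrable u μ) (t : ℝ) :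
    ∫⁻ s in Ioc 0 t, ENNReal.ofReal (decRearr μ u s) < ∞ := by
  refine (lint_upper hu t).trans_lt ?_
  refine (lintegral_mono fun l => min_le_left _ _).trans_lt ?_
  rw [← lintegral_eq_lintegral_meas_lt μ (Filter.Eventually.of_forall fun _ => abs_nonneg _)
    hu.abs.aestronglyMeasurable.aemeasurable,
    ← ofReal_integral_eq_lintegral_ofReal hu.abs (Filter.Eventually.of_forall fun _ => abs_nonneg _)]
  exact ENNReal.ofReal_lt_top

lemma int_eq (hu : Integrable u μ) (t : ℝ) :
    ENNReal.ofReal (∫ s in Ioc 0 t, decRearr μ u s)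
      = ∫⁻ s in Ioc 0 t, ENNReal.ofReal (decRearr μ u s) := by
  rw [integral_eq_lintegral_of_nonneg_ae (Filter.Eventually.of_forall fun _ => decRearr_nonneg _)
    (decRearr_aemeas hu t).aestronglyMeasurable, ENNReal.ofReal_toReal (lint_fin hu t).ne]

/-- Hardy–Littlewood -/
lemma hardy_littlewood (hu : Integrable u μ) {t : ℝ} {E : Set α}
    (hE : μ E ≤ ENNReal.ofReal t) :
    ∫⁻ x in E, ENNReal.ofReal |u x| ∂μ ≤ ∫⁻ s in Ioc 0 t, ENNReal.ofReal (decRearr μ u s) := by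
  refine le_trans ?_ (lint_lower hu)
  rw [lintegral_eq_lintegral_meas_lt (μ.restrict E)
    (Filter.Eventually.of_forall fun _ => abs_nonneg _)
    hu.abs.aestronglyMeasurable.aemeasurable.restrict]
  refine lintegral_mono fun l => le_min ?_ ?_
  · exact Measure.restrict_apply_le _ _
  · exact (measure_mono (subset_univ _)).trans (by simpa using hE)

lemma osc_le (hu : Integrable u μ) {s : ℝ} (hs : 0 < s) :
    ENNReal.ofReal (decRearrAvg μ u s - decRearr μ u s)
      ≤ ENNReal.ofReal (1 / s) * ∫⁻ l in Ioi (decRearr μ u s), μ {x | l < |u x|} := by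
  set d := decRearr μ u s with hd
  have hd0 : 0 ≤ d := decRearr_nonneg s
  have h1 : ENNReal.ofReal (∫ v in Ioc 0 s, decRearr μ u v)
      ≤ ENNReal.ofReal (s * d) + ∫⁻ l in Ioi d, μ {x | l < |u x|} := by
    rw [int_eq hu]
    refine (lint_upper hu s).trans ?_
    rw [← Ioc_union_Ioi_eq_Ioi hd0]
    refine (lintegral_union_le _ _ _).trans (add_le_add ?_ ?_)
    · refine (lintegral_mono fun l => min_le_right _ _).trans ?_
      simp [ENNReal.ofReal_mul hs.le]
    · exact lintegral_mono fun l => min_le_left _ _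
  have h2 : decRearrAvg μ u s - d = 1 / s * ((∫ v in Ioc 0 s, decRearr μ u v) - s * d) := by
    unfold decRearrAvg; field_simp
  rw [h2, ENNReal.ofReal_mul (by positivity)]
  gcongr
  rw [ENNReal.ofReal_sub _ (by positivity)]
  exact tsub_le_iff_left.2 h1

lemma inner_bound {p : ℝ} (hp : 1 < p) (M : ℝ≥0∞) (hM : M ≠ ∞) (t : ℝ) :
    ∫⁻ s in Ioc 0 t, ENNReal.ofReal (s ^ (1 / p - 2)) * (if M ≤ ENNReal.ofReal s then M else 0)
      ≤ ENNReal.ofReal (p / (p - 1)) * M ^ (1 / p) := by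
  rcases eq_or_ne M 0 with h0 | h0
  · simp [h0]
  have hc : 0 < M.toReal := ENNReal.toReal_pos h0 hM
  set c := M.toReal with hcdef
  have hMc : M = ENNReal.ofReal c := (ENNReal.ofReal_toReal hM).symm
  have hq : 1 / p < 1 := by rw [div_lt_one] <;> linarith
  have hint := integrableOn_Ioi_rpow_of_lt (a := 1 / p - 2) (by linarith) hc
  calc _ ≤ ∫⁻ s in Ici c, ENNReal.ofReal (s ^ (1 / p - 2)) * M := by
        rw [← lintegral_indicator measurableSet_Ioc, ← lintegral_indicator measurableSet_Ici]
        refine lintegral_mono fun s => ?_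
        by_cases h1 : s ∈ Ioc 0 t
        · rw [indicator_of_mem h1]
          split_ifs with h2
          · rw [indicator_of_mem]
            rw [hMc] at h2
            exact (ENNReal.ofReal_le_ofReal_iff h1.1.le).1 h2
          · simp
        · rw [indicator_of_notMem h1]; simp
    _ = (∫⁻ s in Ioi c, ENNReal.ofReal (s ^ (1 / p - 2))) * M := by
        rw [setLIntegral_congr Ioi_ae_eq_Ici.symm, lintegral_mul_const' _ _ hM]
    _ = ENNReal.ofReal (-c ^ (1 / p - 2 + 1) / (1 / p - 2 + 1)) * M := by
        rw [← integral_Ioi_rpow_of_lt (by linarith) hc, ofReal_integral_eq_lintegral_ofReal hint]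
        filter_upwards [ae_restrict_mem measurableSet_Ioi] with s hs
        exact Real.rpow_nonneg (hc.trans hs).le _
    _ ≤ _ := by
        rw [hMc, ENNReal.ofReal_rpow_of_pos hc, ← ENNReal.ofReal_mul' hc.le,
          ← ENNReal.ofReal_mul (by apply div_nonneg <;> linarith)]
        refine ENNReal.ofReal_le_ofReal (le_of_eq ?_)
        have h3 : c ^ (1 / p) = c ^ (1 / p - 2 + 1) * c := by
          rw [← Real.rpow_add_one hc.ne']; congr 1; ring
        rw [h3]
        have h4 : (1 / p - 2 + 1) = -((p - 1) / p) := by field_simp; ring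
        rw [h4]
        have h5 : p - 1 ≠ 0 := by linarith
        have h6 : p ≠ 0 := by linarith
        field_simp

lemma dist_meas : Measurable fun l : ℝ => μ {x | l < |u x|} :=
  Antitone.measurable fun _ _ h => measure_mono fun _ hx => lt_of_le_of_lt h hx

lemma osc_int [IsFiniteMeasure μ] (hu : Integrable u μ) {p : ℝ} (hp : 1 < p) (t : ℝ) (ht : 0 < t) :
    ∫⁻ s in Ioc 0 t, ENNReal.ofReal (s ^ (1 / p - 1) * (decRearrAvg μ u s - decRearr μ u s))
      ≤ ENNReal.ofReal (p / (p - 1)) * ∫⁻ l in Ioi (decRearr μ u t), μ {x | l < |u x|} ^ (1 / p) := by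
  calc _ ≤ ∫⁻ s in Ioc 0 t, ∫⁻ l in Ioi (decRearr μ u t), ENNReal.ofReal (s ^ (1 / p - 2)) *
        (if μ {x | l < |u x|} ≤ ENNReal.ofReal s then μ {x | l < |u x|} else 0) := by
        refine setLIntegral_mono' measurableSet_Ioc fun s hs => ?_
        rw [ENNReal.ofReal_mul (Real.rpow_nonneg hs.1.le _),
          lintegral_const_mul' _ _ ENNReal.ofReal_ne_top]
        refine (mul_le_mul_right (osc_le hu hs.1) _).trans ?_
        rw [← mul_assoc, ← ENNReal.ofReal_mul (Real.rpow_nonneg hs.1.le _)]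
        have : s ^ (1 / p - 1) * (1 / s) = s ^ (1 / p - 2) := by
          rw [show 1 / p - 2 = 1 / p - 1 - 1 by ring, Real.rpow_sub_one hs.1.ne' (1 / p - 1)]; ring
        rw [this]
        refine mul_le_mul_right ?_ _
        calc _ = ∫⁻ l in Ioi (decRearr μ u s),
              (if μ {x | l < |u x|} ≤ ENNReal.ofReal s then μ {x | l < |u x|} else 0) := by
              refine setLIntegral_congr_fun measurableSet_Ioi fun l hl => ?_
              rw [if_pos (le_of_decRearr_lt hu hs.1 hl)]
          _ ≤ _ := lintegral_mono_set (Ioi_subset_Ioi (decRearr_anti hu hs.1 ht hs.2))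
    _ = ∫⁻ l in Ioi (decRearr μ u t), ∫⁻ s in Ioc 0 t, ENNReal.ofReal (s ^ (1 / p - 2)) *
        (if μ {x | l < |u x|} ≤ ENNReal.ofReal s then μ {x | l < |u x|} else 0) := by
        refine lintegral_lintegral_swap (Measurable.aemeasurable ?_)
        have h1 : Measurable fun z : ℝ × ℝ => μ {x | z.2 < |u x|} :=
          (dist_meas (μ := μ) (u := u)).comp measurable_snd
        have h2 : Measurable fun z : ℝ × ℝ => ENNReal.ofReal z.1 := by fun_prop
        have h3 : Measurable fun z : ℝ × ℝ => ENNReal.ofReal (z.1 ^ (1 / p - 2)) := by fun_prop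
        exact h3.mul (Measurable.ite (measurableSet_le h1 h2) h1 measurable_const)
    _ ≤ ∫⁻ l in Ioi (decRearr μ u t), ENNReal.ofReal (p / (p - 1)) * μ {x | l < |u x|} ^ (1 / p) :=
        lintegral_mono fun l => inner_bound hp _ (measure_ne_top _ _) t
    _ = _ := lintegral_const_mul' _ _ ENNReal.ofReal_ne_top

lemma sum_bound {q c : ℝ} (hq : 0 ≤ q) {w : α → ℝ≥0∞} 
    (hm : ∀ a b : ℝ, NullMeasurableSet {x | a < |u x| ∧ |u x| < b} μ)
    (hcore : ∀ a b : ℝ, 0 < a → a < b → ENNReal.ofReal (b - a) * μ {x | b < |u x|} ^ q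
      ≤ ENNReal.ofReal c * ∫⁻ x in {x | a < |u x| ∧ |u x| < b}, w x ∂μ)
    {a δ : ℝ} (ha : 0 < a) (hδ : 0 < δ) :
    ∫⁻ l in Ioi (a + δ), μ {x | l < |u x|} ^ q
      ≤ ENNReal.ofReal c * ∫⁻ x in {x | a < |u x|}, w x ∂μ := by
  have hsub : Ioi (a + δ) ⊆ ⋃ k : ℕ, Ico (a + (k + 1) * δ) (a + (k + 2) * δ) := by
    intro x hx
    have hx' : a + δ < x := hx
    refine mem_iUnion.2 ⟨⌊(x - (a + δ)) / δ⌋₊, ?_, ?_⟩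
    · have := Nat.floor_le (a := (x - (a + δ)) / δ) (by apply div_nonneg <;> linarith)
      rw [le_div_iff₀ hδ] at this
      linarith
    · have := Nat.lt_floor_add_one ((x - (a + δ)) / δ)
      rw [div_lt_iff₀ hδ] at this
      linarith
  set A : ℕ → Set α := fun k => {x | a + k * δ < |u x| ∧ |u x| < a + (k + 1) * δ} with hA
  have hdisj : Pairwise (Function.onFun Disjoint A) := by
    have key : ∀ i j : ℕ, i < j → Disjoint (A i) (A j) := by
      intro i j hij
      refine Set.disjoint_left.2 fun x hi hj => ?_
      have h1 : (i : ℝ) + 1 ≤ j := by exact_mod_cast hij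
      have := hi.2
      have := hj.1
      nlinarith
    intro i j hij
    rcases lt_or_gt_of_ne hij with h | h
    · exact key i j h
    · exact (key j i h).symm
  calc _ ≤ ∫⁻ l in ⋃ k : ℕ, Ico (a + (k + 1) * δ) (a + (k + 2) * δ), μ {x | l < |u x|} ^ q :=
        lintegral_mono_set hsub
    _ ≤ ∑' k : ℕ, ∫⁻ l in Ico (a + (k + 1) * δ) (a + (k + 2) * δ), μ {x | l < |u x|} ^ q :=
        lintegral_iUnion_le _ _
    _ ≤ ∑' k : ℕ, ENNReal.ofReal c * ∫⁻ x in A k, w x ∂μ := by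
        refine ENNReal.tsum_le_tsum fun k => ?_
        have h := hcore (a + k * δ) (a + (k + 1) * δ) (by positivity) (by nlinarith)
        refine le_trans ?_ h
        calc _ ≤ ∫⁻ l in Ico (a + (k + 1) * δ) (a + (k + 2) * δ),
              μ {x | a + (k + 1) * δ < |u x|} ^ q := by
              refine setLIntegral_mono' measurableSet_Ico fun l hl => ?_
              refine ENNReal.rpow_le_rpow (measure_mono fun x hx => lt_of_le_of_lt hl.1 hx) hq
          _ ≤ _ := by
              rw [setLIntegral_const, Real.volume_Ico, mul_comm]
              refine le_of_eq ?_
              congr 2; ring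
    _ = ENNReal.ofReal c * ∫⁻ x in ⋃ k, A k, w x ∂μ := by
        rw [ENNReal.tsum_mul_left, lintegral_iUnion₀ (fun k => hm _ _) hdisj.aedisjoint]
    _ ≤ _ := by
        gcongr
        refine iUnion_subset fun k x hx => ?_
        have := hx.1
        have h2 : 0 ≤ (k : ℝ) * δ := by positivity
        show a < |u x|
        linarith

end rearr

lemma int_le_of_lint {α : Type*} [MeasurableSpace α] {μ : Measure α} {F : α → ℝ} {R : ℝ}
    (hR : 0 ≤ R) (h : ∫⁻ x, ENNReal.ofReal (F x) ∂μ ≤ ENNReal.ofReal R) : ∫ x, F x ∂μ ≤ R := by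
  by_cases hF : Integrable F μ
  · rw [integral_eq_lintegral_pos_part_sub_lintegral_neg_part hF]
    have h1 := ENNReal.toReal_mono ENNReal.ofReal_ne_top h
    rw [ENNReal.toReal_ofReal hR] at h1
    have := ENNReal.toReal_nonneg (a := ∫⁻ a, ENNReal.ofReal (-F a) ∂μ)
    linarith
  · rw [integral_undef hF]; exact hR

lemma main_bound {n : ℕ} {Ω : Set (Euc n)} {p C₀ : ℝ} (hp : 1 < p) (hC₀ : 0 < C₀)
    (hΩ : IsOpen Ω) (hvol : volume Ω = 1) (hSP : SPIneq Ω p C₀)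
    {f : Euc n → ℝ} (hf : MemW Ω f) {r : ℝ} (hr : IsMedian Ω f r) {t : ℝ} (ht : 0 < t) :
    ∫⁻ l in Ioi (decRearr (volume.restrict Ω) (fun x => f x - r) t),
        (volume.restrict Ω) {x | l < |f x - r|} ^ (1 / p)
      ≤ ENNReal.ofReal (4 * C₀) *
        ∫⁻ s in Ioc 0 t, ENNReal.ofReal (decRearr (volume.restrict Ω) (gradNorm f) s) := by
  have hprob : IsProbabilityMeasure (volume.restrict Ω) := ⟨by simp [hvol]⟩
  have hu : Integrable (fun x => f x - r) (volume.restrict Ω) := hf.2.1.sub (integrable_const r)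
  have hg : Integrable (gradNorm f) (volume.restrict Ω) := hf.2.2
  have hm : ∀ a b : ℝ, NullMeasurableSet {x | a < |f x - r| ∧ |f x - r| < b}
      (volume.restrict Ω) := fun a b =>
    (nullMeasurableSet_lt aemeasurable_const hu.abs.aestronglyMeasurable.aemeasurable).inter
      (nullMeasurableSet_lt hu.abs.aestronglyMeasurable.aemeasurable aemeasurable_const)
  have hcore : ∀ a b : ℝ, 0 < a → a < b →
      ENNReal.ofReal (b - a) * (volume.restrict Ω) {x | b < |f x - r|} ^ (1 / p)
      ≤ ENNReal.ofReal (4 * C₀) * ∫⁻ x in {x | a < |f x - r| ∧ |f x - r| < b},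
          ENNReal.ofReal |gradNorm f x| ∂(volume.restrict Ω) := by
    intro a b ha hab
    have h := ENNReal.ofReal_le_ofReal (core_real hp hΩ hvol hSP hf hr ha hab)
    have hgn : ∀ x, |gradNorm f x| = gradNorm f x := fun x => abs_of_nonneg (norm_nonneg _)
    rw [ENNReal.ofReal_mul (by linarith), ENNReal.ofReal_mul (by positivity),
      ← ENNReal.ofReal_rpow_of_nonneg measureReal_nonneg (by positivity),
      ofReal_measureReal (measure_ne_top _ _)] at h
    rw [Measure.restrict_restrict₀ (hm a b), inter_comm]
    simp only [hgn]
    rw [← ofReal_integral_eq_lintegral_ofReal]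
    · exact h
    · exact hf.2.2.mono_set inter_subset_left
    · exact Filter.Eventually.of_forall fun x => norm_nonneg _
  set d := decRearr (volume.restrict Ω) (fun x => f x - r) t with hd
  have hd0 : 0 ≤ d := decRearr_nonneg t
  have hU : Ioi d ⊆ ⋃ k : ℕ, Ioi (d + 1 / ((k : ℝ) + 1) + 1 / ((k : ℝ) + 1)) := by
    intro x hx
    obtain ⟨k, hk⟩ := exists_nat_one_div_lt (show (0 : ℝ) < (x - d) / 2 from half_pos (sub_pos.2 hx))
    refine mem_iUnion.2 ⟨k, ?_⟩
    show _ < x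
    linarith
  refine (lintegral_mono_set hU).trans ?_
  rw [setLIntegral_iUnion_of_directed]
  · refine iSup_le fun k => ?_
    have hk : (0 : ℝ) < 1 / ((k : ℝ) + 1) := by positivity
    refine (sum_bound (u := fun x => f x - r) (by positivity : 0 ≤ 1 / p) hm hcore
      (by linarith : 0 < d + 1 / ((k : ℝ) + 1)) hk).trans ?_
    refine mul_le_mul_right ?_ _
    exact hardy_littlewood hg (le_of_decRearr_lt hu ht (by linarith))
  · refine Monotone.directed_le fun i j hij => Ioi_subset_Ioi ?_
    have : 1 / ((j : ℝ) + 1) ≤ 1 / ((i : ℝ) + 1) := one_div_le_one_div_of_le (by positivity)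
      (by exact_mod_cast Nat.succ_le_succ hij)
    linarith

/-- If `Ω` satisfies the `p`-Sobolev–Poincaré inequality with constant `C₀`
(`1 < p ≤ n/(n−1)`), then there is `C = C(p, C₀)` such that for every
`f ∈ W(Ω)`, every median `r` of `f` and every `t ∈ (0,1)`:
`∫₀ᵗ s^{1/p−1} [(f − r)**(s) − (f − r)*(s)] ds ≤ C ∫₀ᵗ |∇f|*(s) ds`. -/
theorem stmt4 (p C₀ : ℝ) (hp : 1 < p) (hC₀ : 0 < C₀) :
    ∃ C : ℝ, 0 < C ∧ ∀ n : ℕ, 2 ≤ n → ∀ Ω : Set (Euc n),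
      IsOpen Ω → IsConnected Ω → volume Ω = 1 → p ≤ (n : ℝ) / ((n : ℝ) - 1) →
      SPIneq Ω p C₀ →
      ∀ f : Euc n → ℝ, MemW Ω f → ∀ r : ℝ, IsMedian Ω f r →
      ∀ t ∈ Ioo (0 : ℝ) 1,
        (∫ s in Ioc (0 : ℝ) t, s ^ (1 / p - 1) *
            (decRearrAvg (volume.restrict Ω) (fun x => f x - r) s
              - decRearr (volume.restrict Ω) (fun x => f x - r) s))
          ≤ C * ∫ s in Ioc (0 : ℝ) t, decRearr (volume.restrict Ω) (gradNorm f) s := by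
  have hpp : 0 < p / (p - 1) := div_pos (by linarith) (by linarith)
  refine ⟨p / (p - 1) * (4 * C₀), by positivity, ?_⟩
  intro n _ Ω hΩ _ hvol _ hSP f hf r hr t ht
  have hprob : IsProbabilityMeasure (volume.restrict Ω) := ⟨by simp [hvol]⟩
  have hu : Integrable (fun x => f x - r) (volume.restrict Ω) := hf.2.1.sub (integrable_const r)
  have hg : Integrable (gradNorm f) (volume.restrict Ω) := hf.2.2
  have hR0 : 0 ≤ ∫ s in Ioc (0 : ℝ) t, decRearr (volume.restrict Ω) (gradNorm f) s :=
    integral_nonneg fun _ => decRearr_nonneg _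
  refine int_le_of_lint (by positivity) ?_
  refine (osc_int hu hp t ht.1).trans ?_
  rw [mul_assoc, ENNReal.ofReal_mul hpp.le]
  refine mul_le_mul_right ?_ _
  rw [ENNReal.ofReal_mul (by positivity), int_eq hg]
  exact main_bound hp hC₀ hΩ hvol hSP hf hr ht.1
end
end

section
/- Let 1 ≤ p ≤ n/(n−1). The following are equivalent: (i) there exists C₀ such that (∫_Ω |f(x) − f_Ω|^p dx)^{1/p} ≤ C₀ ∫_Ω |∇f(x)| dx for every f ∈ W(Ω); (ii) there exists C₁ such that ‖f − f_Ω‖_{L^{p,1}(Ω)} ≤ C₁ ∫_Ω |∇f(x)| dx for every f ∈ W(Ω). -/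
open MeasureTheory Set
open scoped ENNReal NNReal

noncomputable section

lemma cheb5 {α : Type*} [MeasurableSpace α] (μ : Measure α) (p : ℝ) (hp1 : 1 ≤ p)
    (g : α → ℝ) (hg : AEStronglyMeasurable g μ) (ε : ℝ) (E : Set α) (hE : ∀ x ∈ E, ε ≤ |g x|) :
    ENNReal.ofReal ε * μ E ^ (1 / p) ≤ eLpNorm g (ENNReal.ofReal p) μ := by
  have hp0 : 0 < p := by linarith
  have h := mul_meas_ge_le_pow_eLpNorm' μ (p := ENNReal.ofReal p) (by simpa using hp0)
    ENNReal.ofReal_ne_top hg (ENNReal.ofReal ε)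
  rw [ENNReal.toReal_ofReal hp0.le] at h
  have h2 : ENNReal.ofReal ε ^ p * μ E ≤ eLpNorm g (ENNReal.ofReal p) μ ^ p := by
    refine le_trans ?_ h
    gcongr
    intro x hx
    simp only [mem_ofPred_eq]
    rw [Real.enorm_eq_ofReal_abs]
    exact ENNReal.ofReal_le_ofReal (hE x hx)
  have h3 := ENNReal.rpow_le_rpow h2 (z := 1 / p) (by positivity)
  rw [ENNReal.mul_rpow_of_nonneg _ _ (by positivity), ← ENNReal.rpow_mul, ← ENNReal.rpow_mul,
    mul_one_div_cancel hp0.ne'] at h3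
  simpa using h3

/-- integral of the power weight below level D -/
lemma weight5 (p : ℝ) (hp1 : 1 ≤ p) (D : ℝ≥0∞) (hD : D ≤ 1) :
    ∫⁻ t in Ioc (0 : ℝ) 1, ENNReal.ofReal (t ^ (1 / p - 1)) *
      ({s : ℝ | ENNReal.ofReal s < D}.indicator (fun _ => 1) t) = ENNReal.ofReal p * D ^ (1 / p) := by
  have hp0 : 0 < p := by linarith
  obtain ⟨d, rfl⟩ : ∃ d : ℝ≥0, D = d := ⟨D.toNNReal, (ENNReal.coe_toNNReal (by
    exact ne_top_of_le_ne_top ENNReal.one_ne_top hD)).symm⟩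
  have hd1 : (d : ℝ) ≤ 1 := by exact_mod_cast hD
  have e1 : ∀ t : ℝ, ENNReal.ofReal (t ^ (1 / p - 1)) *
      ({s : ℝ | ENNReal.ofReal s < (d : ℝ≥0∞)}.indicator (fun _ => 1) t) =
      {s : ℝ | ENNReal.ofReal s < (d : ℝ≥0∞)}.indicator
        (fun t => ENNReal.ofReal (t ^ (1 / p - 1))) t := by
    intro t
    by_cases h : t ∈ {s : ℝ | ENNReal.ofReal s < (d : ℝ≥0∞)}
    · simp [indicator_of_mem h]
    · simp [indicator_of_notMem h]
  simp_rw [e1]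
  rw [lintegral_indicator (measurableSet_lt ENNReal.measurable_ofReal measurable_const),
    Measure.restrict_restrict (measurableSet_lt ENNReal.measurable_ofReal measurable_const)]
  have e2 : {s : ℝ | ENNReal.ofReal s < (d : ℝ≥0∞)} ∩ Ioc 0 1 = Ioo 0 (d : ℝ) := by
    ext s
    simp only [mem_inter_iff, mem_ofPred_eq, mem_Ioc, mem_Ioo]
    constructor
    · rintro ⟨h, h0, h1⟩
      refine ⟨h0, ?_⟩
      rw [← ENNReal.ofReal_coe_nnreal] at h
      exact (ENNReal.ofReal_lt_ofReal_iff_of_nonneg h0.le).1 h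
    · rintro ⟨h0, h⟩
      refine ⟨?_, h0, by linarith⟩
      rw [← ENNReal.ofReal_coe_nnreal]
      exact (ENNReal.ofReal_lt_ofReal_iff_of_nonneg h0.le).2 h
  rw [e2, restrict_Ioo_eq_restrict_Ioc]
  have hr : -1 < 1 / p - 1 := by
    have : 0 < 1 / p := by positivity
    linarith
  have hi := (intervalIntegral.intervalIntegrable_rpow' (a := 0) (b := (d : ℝ)) hr)
  rw [intervalIntegrable_iff_integrableOn_Ioc_of_le d.coe_nonneg] at hi
  rw [← ofReal_integral_eq_lintegral_ofReal hi]
  · rw [← intervalIntegral.integral_of_le d.coe_nonneg, integral_rpow (Or.inl hr)]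
    have : 1 / p - 1 + 1 = 1 / p := by ring
    rw [this, Real.zero_rpow (by positivity), sub_zero, ← ENNReal.ofReal_coe_nnreal,
      ENNReal.ofReal_rpow_of_nonneg d.coe_nonneg (by positivity), ← ENNReal.ofReal_mul hp0.le]
    congr 1
    field_simp
  · filter_upwards [ae_restrict_mem measurableSet_Ioc] with t ht
    exact Real.rpow_nonneg ht.1.le _

lemma decRearr_nonneg5 {α : Type*} [MeasurableSpace α] (μ : Measure α) (u : α → ℝ) (t : ℝ) :
    0 ≤ decRearr μ u t := Real.sInf_nonneg (fun _ h => h.1)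

lemma decRearr_le5 {α : Type*} [MeasurableSpace α] (μ : Measure α) (u : α → ℝ) (t l : ℝ)
    (h0 : 0 ≤ l) (h : μ {x | l < |u x|} ≤ ENNReal.ofReal t) : decRearr μ u t ≤ l :=
  csInf_le ⟨0, fun _ h => h.1⟩ ⟨h0, h⟩

lemma dist_tendsto5 {α : Type*} [MeasurableSpace α] (μ : Measure α) [IsFiniteMeasure μ]
    (u : α → ℝ) (hu : AEStronglyMeasurable u μ) (l h : ℝ) (hh : 0 < h) (t : ℝ) (ht : 0 < t) :
    ∃ k : ℕ, μ {x | l + k * h < |u x|} ≤ ENNReal.ofReal t := by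
  have key : Filter.Tendsto (fun k : ℕ => μ {x | l + k * h < |u x|}) Filter.atTop (nhds 0) := by
    have hI : (⋂ k : ℕ, {x | l + k * h < |u x|}) = ∅ := by
      ext x
      simp only [mem_iInter, mem_ofPred_eq, mem_empty_iff_false, iff_false, not_forall, not_lt]
      obtain ⟨k, hk⟩ := exists_nat_gt ((|u x| - l) / h)
      rw [div_lt_iff₀ hh] at hk
      exact ⟨k, by linarith⟩
    have := tendsto_measure_iInter_atTop (μ := μ) (s := fun k : ℕ => {x | l + k * h < |u x|})
      (fun k => nullMeasurableSet_lt aemeasurable_const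
        (by simpa using hu.aemeasurable.norm)) ?_ ⟨0, measure_ne_top _ _⟩
    · rwa [hI, measure_empty] at this
    · intro i j hij x hx
      simp only [mem_ofPred_eq] at hx ⊢
      have : (i : ℝ) ≤ j := by exact_mod_cast hij
      nlinarith
  have := (key.eventually (gt_mem_nhds (ENNReal.ofReal_pos.2 ht))).exists
  obtain ⟨k, hk⟩ := this
  exact ⟨k, hk.le⟩

lemma upper5 {α : Type*} [MeasurableSpace α] (μ : Measure α) [IsProbabilityMeasure μ]
    (p : ℝ) (hp1 : 1 ≤ p)
    (u : α → ℝ) (hu : AEStronglyMeasurable u μ) (l h : ℝ) (hl : 0 ≤ l) (hh : 0 < h) :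
    ∫⁻ t in Ioc (0 : ℝ) 1, ENNReal.ofReal (t ^ (1 / p - 1) * decRearr μ u t) ≤
      ENNReal.ofReal p * (ENNReal.ofReal l +
        ENNReal.ofReal h * ∑' k : ℕ, μ {x | l + k * h < |u x|} ^ (1 / p)) := by
  set D : ℕ → ℝ≥0∞ := fun k => μ {x | l + k * h < |u x|} with hD
  have hpt : ∀ t ∈ Ioc (0 : ℝ) 1, ENNReal.ofReal (t ^ (1 / p - 1) * decRearr μ u t) ≤
      ENNReal.ofReal (t ^ (1 / p - 1)) * ({s : ℝ | ENNReal.ofReal s < 1}.indicator (fun _ => 1) t)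
        * ENNReal.ofReal l +
      ENNReal.ofReal h * ∑' k : ℕ, ENNReal.ofReal (t ^ (1 / p - 1)) *
        ({s : ℝ | ENNReal.ofReal s < D k}.indicator (fun _ => 1) t) ∨ t = 1 := by
    intro t ht
    by_cases ht1 : t = 1
    · exact Or.inr ht1
    left
    have hlt : t < 1 := lt_of_le_of_ne ht.2 ht1
    have m1 : t ∈ {s : ℝ | ENNReal.ofReal s < 1} := by
      simpa using hlt
    rw [indicator_of_mem m1, mul_one, ENNReal.tsum_mul_left,
      ENNReal.ofReal_mul (Real.rpow_nonneg ht.1.le _), mul_left_comm, ← mul_add]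
    gcongr
    classical
    have hex := dist_tendsto5 μ u hu l h hh t ht.1
    have hK := Nat.find_spec hex
    have hmin := fun k => Nat.find_min hex (m := k)
    set K := Nat.find hex
    have h1 : decRearr μ u t ≤ l + K * h := decRearr_le5 μ u t _ (by positivity) hK
    have h2 : (K : ℝ≥0∞) ≤ ∑' k : ℕ, ({s : ℝ | ENNReal.ofReal s < D k}.indicator (fun _ => 1) t) := by
      calc (K : ℝ≥0∞) = ∑ k ∈ Finset.range K, 1 := by simp
        _ = ∑ k ∈ Finset.range K, ({s : ℝ | ENNReal.ofReal s < D k}.indicator (fun _ => 1) t) := by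
            refine Finset.sum_congr rfl fun k hk => ?_
            rw [indicator_of_mem]
            exact not_le.1 (hmin k (Finset.mem_range.1 hk))
        _ ≤ _ := ENNReal.sum_le_tsum _
    calc ENNReal.ofReal (decRearr μ u t) ≤ ENNReal.ofReal (l + K * h) := ENNReal.ofReal_le_ofReal h1
      _ = ENNReal.ofReal l + ENNReal.ofReal h * K := by
          rw [ENNReal.ofReal_add hl (by positivity), ENNReal.ofReal_mul (by positivity), mul_comm]
          simp
      _ ≤ _ := by gcongr
  have hmw : Measurable (fun t : ℝ => ENNReal.ofReal (t ^ (1 / p - 1))) := by fun_prop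
  have hmi : ∀ d : ℝ≥0∞, Measurable
      (fun t : ℝ => ({s : ℝ | ENNReal.ofReal s < d}.indicator (fun _ => (1 : ℝ≥0∞)) t)) := fun d =>
    measurable_const.indicator (measurableSet_lt ENNReal.measurable_ofReal measurable_const)
  have hmm : ∀ d : ℝ≥0∞, Measurable (fun t : ℝ => ENNReal.ofReal (t ^ (1 / p - 1)) *
      ({s : ℝ | ENNReal.ofReal s < d}.indicator (fun _ => (1 : ℝ≥0∞)) t)) := fun d =>
    hmw.mul (hmi d)
  calc _ ≤ ∫⁻ t in Ioc (0 : ℝ) 1, (ENNReal.ofReal (t ^ (1 / p - 1)) * ({s : ℝ | ENNReal.ofReal s < 1}.indicator (fun _ => 1) t)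
        * ENNReal.ofReal l +
      ENNReal.ofReal h * ∑' k : ℕ, ENNReal.ofReal (t ^ (1 / p - 1)) *
        ({s : ℝ | ENNReal.ofReal s < D k}.indicator (fun _ => 1) t)) := by
        apply lintegral_mono_ae
        have hne : ∀ᵐ t : ℝ ∂(volume.restrict (Ioc (0 : ℝ) 1)), t ≠ 1 :=
          ae_restrict_of_ae (Measure.ae_ne volume 1)
        filter_upwards [ae_restrict_mem measurableSet_Ioc, hne] with t ht h1
        exact (hpt t ht).resolve_right h1
    _ = _ := by
        rw [lintegral_add_left ((hmm 1).mul_const _), lintegral_mul_const _ (hmm 1),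
          lintegral_const_mul _ (Measurable.tsum fun k => (hmm (D k))),
          lintegral_tsum (fun k => (hmm (D k)).aemeasurable), weight5 p hp1 1 le_rfl]
        simp_rw [fun k => weight5 p hp1 (D k) prob_le_one]
        rw [ENNReal.tsum_mul_left]
        simp only [ENNReal.one_rpow]
        ring

lemma decRearr_ge5 {α : Type*} [MeasurableSpace α] (μ : Measure α) (u : α → ℝ) (M : ℝ)
    (hM0 : 0 ≤ M) (hM : ∀ x, |u x| ≤ M) (t l : ℝ)
    (h : ENNReal.ofReal t < μ {x | l < |u x|}) : l ≤ decRearr μ u t := by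
  refine le_csInf ⟨M, hM0, ?_⟩ ?_
  · have : {x | M < |u x|} = ∅ := by
      ext x; simpa using hM x
    rw [this]; simp
  · rintro b ⟨hb0, hb⟩
    by_contra hlt
    push Not at hlt
    have : μ {x | l < |u x|} ≤ μ {x | b < |u x|} := measure_mono fun x hx => lt_trans hlt hx
    exact absurd (h.trans_le (this.trans hb)) (lt_irrefl _)

lemma decRearr_anti5 {α : Type*} [MeasurableSpace α] (μ : Measure α) (u : α → ℝ) (M : ℝ)
    (hM0 : 0 ≤ M) (hM : ∀ x, |u x| ≤ M) : Antitone (decRearr μ u) := by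
  intro s t hst
  refine csInf_le_csInf ⟨0, fun _ h => h.1⟩ ⟨M, hM0, ?_⟩ ?_
  · have : {x | M < |u x|} = ∅ := by
      ext x; simpa using hM x
    rw [this]; simp
  · rintro b ⟨hb0, hb⟩
    exact ⟨hb0, hb.trans (ENNReal.ofReal_le_ofReal hst)⟩

lemma integrable5 {α : Type*} [MeasurableSpace α] (μ : Measure α) (p : ℝ) (hp1 : 1 ≤ p)
    (u : α → ℝ) (M : ℝ) (hM0 : 0 ≤ M) (hM : ∀ x, |u x| ≤ M) :
    IntegrableOn (fun t => t ^ (1 / p - 1) * decRearr μ u t) (Ioc (0 : ℝ) 1) := by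
  have hr : -1 < 1 / p - 1 := by
    have : 0 < 1 / p := by positivity
    linarith
  have hi := (intervalIntegral.intervalIntegrable_rpow' (a := 0) (b := 1) hr)
  rw [intervalIntegrable_iff_integrableOn_Ioc_of_le zero_le_one] at hi
  refine Integrable.mul_bdd (c := M) hi
    (decRearr_anti5 μ u M hM0 hM).measurable.aestronglyMeasurable ?_
  refine Filter.Eventually.of_forall fun t => ?_
  rw [Real.norm_of_nonneg (decRearr_nonneg5 _ _ _)]
  refine decRearr_le5 _ _ _ _ hM0 ?_
  have : {x | M < |u x|} = ∅ := by
    ext x; simpa using hM x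
  rw [this]; simp

lemma lower5 {α : Type*} [MeasurableSpace α] (μ : Measure α) [IsProbabilityMeasure μ]
    (p : ℝ) (hp1 : 1 ≤ p)
    (u : α → ℝ) (hu : AEStronglyMeasurable u μ) (M : ℝ) (hM0 : 0 ≤ M) (hM : ∀ x, |u x| ≤ M) :
    eLpNorm u (ENNReal.ofReal p) μ ≤
      ENNReal.ofReal (∫ t in Ioc (0 : ℝ) 1, t ^ (1 / p - 1) * decRearr μ u t) := by
  have hp0 : 0 < p := by linarith
  refine ENNReal.le_of_forall_pos_le_add fun h hh _ => ?_
  have hh' : 0 < (h : ℝ) := hh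
  obtain ⟨K, hK⟩ := exists_nat_gt (M / h)
  rw [div_lt_iff₀ hh'] at hK
  set A : ℕ → Set α := fun k => {x | ((k : ℝ) + 1) * h < |u x|} with hA
  have hAn : ∀ k, NullMeasurableSet (A k) μ := fun k =>
    nullMeasurableSet_lt aemeasurable_const (by simpa using hu.aemeasurable.norm)
  -- Minkowski
  have step1 : eLpNorm u (ENNReal.ofReal p) μ ≤
      h + h * ∑ k ∈ Finset.range K, μ (A k) ^ (1 / p) := by
    have hle : ∀ x, ‖u x‖ ≤ ((fun _ => (h : ℝ)) + ∑ k ∈ Finset.range K, (A k).indicator (fun _ => (h : ℝ)) : α → ℝ) x := by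
      intro x
      simp only [Pi.add_apply, Finset.sum_apply]
      rw [Real.norm_eq_abs]
      -- induct
      have : ∀ N : ℕ, |u x| ≤ (N : ℝ) * h + h → |u x| ≤
          h + ∑ k ∈ Finset.range N, (A k).indicator (fun _ => (h : ℝ)) x := by
        intro N
        induction N with
        | zero => intro hx; simpa using hx
        | succ N ih =>
          intro hx
          rw [Finset.sum_range_succ]
          by_cases hxN : x ∈ A N
          · have hall : ∀ k ∈ Finset.range N, (A k).indicator (fun _ => (h : ℝ)) x = h := by
              intro k hk
              apply indicator_of_mem
              have hk' : (k : ℝ) ≤ N := by exact_mod_cast (Finset.mem_range.1 hk).le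
              simp only [hA, mem_ofPred_eq] at hxN ⊢
              nlinarith
            rw [Finset.sum_congr rfl hall, indicator_of_mem hxN]
            simp only [Finset.sum_const, Finset.card_range, nsmul_eq_mul]
            push_cast at hx
            linarith
          · rw [indicator_of_notMem hxN, add_zero]
            apply ih
            simp only [hA, mem_ofPred_eq, not_lt] at hxN
            linarith
      apply this
      linarith [hM x]
    have hone : 1 ≤ ENNReal.ofReal p := by simpa using hp1
    have hmeasI : ∀ k ∈ Finset.range K,
        AEStronglyMeasurable ((A k).indicator (fun _ => (h : ℝ))) μ := fun k _ =>
      (aestronglyMeasurable_const (b := (h : ℝ))).indicator₀ (hAn k)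
    calc eLpNorm u (ENNReal.ofReal p) μ ≤ eLpNorm ((fun _ => (h : ℝ)) + ∑ k ∈ Finset.range K, (A k).indicator (fun _ => (h : ℝ))) (ENNReal.ofReal p) μ :=
          eLpNorm_mono_real hle
      _ ≤ eLpNorm (fun _ => (h : ℝ)) (ENNReal.ofReal p) μ + eLpNorm (∑ k ∈ Finset.range K, (A k).indicator (fun _ => (h : ℝ))) (ENNReal.ofReal p) μ :=
          eLpNorm_add_le aestronglyMeasurable_const
            (Finset.aestronglyMeasurable_sum _ hmeasI) hone
      _ ≤ h + ∑ k ∈ Finset.range K, eLpNorm ((A k).indicator (fun _ => (h : ℝ))) (ENNReal.ofReal p) μ := by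
          gcongr
          · rw [eLpNorm_const _ (by simpa using hp0) (IsProbabilityMeasure.ne_zero μ)]
            simp [Real.enorm_eq_ofReal_abs]
          · exact eLpNorm_sum_le hmeasI hone
      _ ≤ h + ∑ k ∈ Finset.range K, h * μ (A k) ^ (1 / p) := by
          gcongr with k hk
          refine (eLpNorm_indicator_const_le _ _).trans ?_
          rw [ENNReal.toReal_ofReal hp0.le]
          simp [Real.enorm_eq_ofReal_abs]
      _ = _ := by rw [Finset.mul_sum]
  refine step1.trans ?_
  rw [add_comm]
  gcongr
  rw [ofReal_integral_eq_lintegral_ofReal (integrable5 μ p hp1 u M hM0 hM)]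
  swap
  · filter_upwards [ae_restrict_mem measurableSet_Ioc] with t ht
    exact mul_nonneg (Real.rpow_nonneg ht.1.le _) (decRearr_nonneg5 _ _ _)
  have hmw : Measurable (fun t : ℝ => ENNReal.ofReal (t ^ (1 / p - 1))) := by fun_prop
  have hmi : ∀ d : ℝ≥0∞, Measurable
      (fun t : ℝ => ({s : ℝ | ENNReal.ofReal s < d}.indicator (fun _ => (1 : ℝ≥0∞)) t)) := fun d =>
    measurable_const.indicator (measurableSet_lt ENNReal.measurable_ofReal measurable_const)
  have hmm : ∀ d : ℝ≥0∞, Measurable (fun t : ℝ => ENNReal.ofReal (t ^ (1 / p - 1)) *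
      ({s : ℝ | ENNReal.ofReal s < d}.indicator (fun _ => (1 : ℝ≥0∞)) t)) := fun d =>
    hmw.mul (hmi d)
  calc (h : ℝ≥0∞) * ∑ k ∈ Finset.range K, μ (A k) ^ (1 / p)
      ≤ h * ∑ k ∈ Finset.range K, ENNReal.ofReal p * μ (A k) ^ (1 / p) := by
        gcongr with k hk
        refine le_mul_of_one_le_left' ?_
        simpa using hp1
    _ = ∫⁻ t in Ioc (0 : ℝ) 1, h * ∑ k ∈ Finset.range K, ENNReal.ofReal (t ^ (1 / p - 1)) *
        ({s : ℝ | ENNReal.ofReal s < μ (A k)}.indicator (fun _ => 1) t) := by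
        rw [lintegral_const_mul _ (Finset.measurable_fun_sum _ fun k _ => hmm (μ (A k))),
          lintegral_finsetSum _ (fun k _ => hmm (μ (A k)))]
        simp_rw [fun k => weight5 p hp1 (μ (A k)) prob_le_one]
    _ ≤ _ := by
        refine setLIntegral_mono' measurableSet_Ioc fun t ht => ?_
        rw [← Finset.mul_sum, mul_left_comm, ENNReal.ofReal_mul (Real.rpow_nonneg ht.1.le _)]
        gcongr
        have : ∀ N : ℕ, ∃ j : ℕ, (h : ℝ≥0∞) * ∑ k ∈ Finset.range N,
            ({s : ℝ | ENNReal.ofReal s < μ (A k)}.indicator (fun _ => 1) t) = ENNReal.ofReal (j * h) ∧ j ≤ N ∧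
              (j : ℝ) * h ≤ decRearr μ u t := by
          intro N
          induction N with
          | zero => exact ⟨0, by simp, le_rfl, by simpa using decRearr_nonneg5 _ _ _⟩
          | succ N ih =>
            obtain ⟨j, hj, hjN, hjd⟩ := ih
            by_cases hm : t ∈ {s : ℝ | ENNReal.ofReal s < μ (A N)}
            · refine ⟨j + 1, ?_, by omega, ?_⟩
              · rw [Finset.sum_range_succ, mul_add, hj, indicator_of_mem hm, mul_one]
                push_cast
                rw [add_mul, one_mul, ENNReal.ofReal_add (by positivity) (by positivity)]
                simp
              · have := decRearr_ge5 μ u M hM0 hM t _ hm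
                have hj' : (j : ℝ) ≤ N := by exact_mod_cast hjN
                push_cast
                nlinarith
            · refine ⟨j, ?_, by omega, hjd⟩
              rw [Finset.sum_range_succ, mul_add, hj, indicator_of_notMem hm]
              simp
        obtain ⟨j, hj, -, hjd⟩ := this K
        rw [hj]
        exact ENNReal.ofReal_le_ofReal hjd

def tr5 (a b y : ℝ) : ℝ := max a (min y b)

lemma tr5_lip (a b : ℝ) : LipschitzWith 1 (tr5 a b) :=
  (LipschitzWith.id.min_const b).const_max a

lemma tr5_bd (a b y : ℝ) : |tr5 a b y| ≤ max |a| |b| := by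
  unfold tr5
  rcases le_total a (min y b) with h | h
  · rw [max_eq_right h]
    rw [abs_le]
    constructor
    · have := neg_abs_le a
      have := le_max_left |a| |b|
      linarith
    · have := le_abs_self b
      have := le_max_right |a| |b|
      have := min_le_right y b
      linarith
  · rw [max_eq_left h]; exact le_max_left _ _

lemma contAt5 {n : ℕ} {Ω : Set (Euc n)} {f : Euc n → ℝ} (hf : MemW Ω f) (x : Euc n) (hx : x ∈ Ω) :
    ContinuousAt f x := by
  obtain ⟨s, hs, K, hK⟩ := hf.1 x hx
  exact hK.continuousOn.continuousAt hs

lemma tr5_grad {n : ℕ} {Ω : Set (Euc n)} {f : Euc n → ℝ} (hf : MemW Ω f) (a b : ℝ) (hab : a < b)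
    (x : Euc n) (hx : x ∈ Ω) :
    gradNorm (fun y => tr5 a b (f y)) x = (f ⁻¹' Ioo a b).indicator (gradNorm f) x := by
  by_cases h : x ∈ f ⁻¹' Ioo a b
  · rw [indicator_of_mem h]
    unfold gradNorm
    have : (fun y => tr5 a b (f y)) =ᶠ[nhds x] f := by
      filter_upwards [(contAt5 hf x hx).preimage_mem_nhds (isOpen_Ioo.mem_nhds h)] with y hy
      simp only [mem_preimage, mem_Ioo] at hy
      unfold tr5
      rw [min_eq_left hy.2.le, max_eq_right hy.1.le]
    rw [this.fderiv_eq]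
  · rw [indicator_of_notMem h]
    unfold gradNorm
    rw [norm_eq_zero]
    by_cases ha : f x ≤ a
    · apply IsLocalMin.fderiv_eq_zero
      refine Filter.Eventually.of_forall fun y => ?_
      simp only [tr5]
      rw [min_eq_left (by linarith), max_eq_left ha]
      exact le_max_left _ _
    · have hb : b ≤ f x := by
        by_contra hb
        exact h ⟨not_le.1 ha, not_le.1 hb⟩
      apply IsLocalMax.fderiv_eq_zero
      refine Filter.Eventually.of_forall fun y => ?_
      simp only [tr5]
      rw [min_eq_right hb, max_eq_right hab.le]
      exact max_le hab.le (min_le_right _ _)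

lemma gradNorm_meas5 {n : ℕ} (f : Euc n → ℝ) : Measurable (gradNorm f) :=
  (measurable_fderiv ℝ f).norm

lemma gradNorm_nonneg5 {n : ℕ} (f : Euc n → ℝ) (x : Euc n) : 0 ≤ gradNorm f x := norm_nonneg _

lemma tr5_memW {n : ℕ} {Ω : Set (Euc n)} (hΩo : IsOpen Ω) (hΩ1 : volume Ω = 1)
    {f : Euc n → ℝ} (hf : MemW Ω f) (a b : ℝ) (hab : a < b) :
    MemW Ω (fun y => tr5 a b (f y)) := by
  have : IsProbabilityMeasure (volume.restrict Ω) := ⟨by simpa using hΩ1⟩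
  refine ⟨?_, ?_, ?_⟩
  · intro x hx
    obtain ⟨s, hs, K, hK⟩ := hf.1 x hx
    exact ⟨s, hs, _, (tr5_lip a b).comp_lipschitzOnWith hK⟩
  · refine Integrable.of_bound (C := max |a| |b|)
      ((tr5_lip a b).continuous.comp_aestronglyMeasurable hf.2.1.1) ?_
    exact Filter.Eventually.of_forall fun x => by simpa using tr5_bd a b (f x)
  · refine Integrable.mono hf.2.2 (gradNorm_meas5 _).aestronglyMeasurable ?_
    filter_upwards [ae_restrict_mem hΩo.measurableSet] with x hx
    rw [tr5_grad hf a b hab x hx]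
    exact norm_indicator_le_norm_self _ _

lemma tr5_int_le {n : ℕ} {Ω : Set (Euc n)} (hΩo : IsOpen Ω) (hΩ1 : volume Ω = 1)
    {f : Euc n → ℝ} (hf : MemW Ω f) (a b : ℝ) (hab : a < b) :
    ∫ x in Ω, gradNorm (fun y => tr5 a b (f y)) x ≤ ∫ x in Ω, gradNorm f x := by
  refine setIntegral_mono_on (tr5_memW hΩo hΩ1 hf a b hab).2.2 hf.2.2 hΩo.measurableSet ?_
  intro x hx
  rw [tr5_grad hf a b hab x hx]
  exact indicator_le_self' (fun _ _ => gradNorm_nonneg5 _ _) x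

lemma tr5_int_eq {n : ℕ} {Ω : Set (Euc n)} (hΩo : IsOpen Ω) (hΩ1 : volume Ω = 1)
    {f : Euc n → ℝ} (hf : MemW Ω f) (a b : ℝ) (hab : a < b) :
    ENNReal.ofReal (∫ x in Ω, gradNorm (fun y => tr5 a b (f y)) x) =
      ∫⁻ x in Ω ∩ f ⁻¹' Ioo a b, ENNReal.ofReal (gradNorm f x) := by
  have hcont : ContinuousOn f Ω := fun x hx => (contAt5 hf x hx).continuousWithinAt
  have hms : MeasurableSet (Ω ∩ f ⁻¹' Ioo a b) :=
    (hcont.isOpen_inter_preimage hΩo isOpen_Ioo).measurableSet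
  rw [ofReal_integral_eq_lintegral_ofReal (tr5_memW hΩo hΩ1 hf a b hab).2.2
    (Filter.Eventually.of_forall fun x => gradNorm_nonneg5 _ _)]
  rw [← inter_eq_right.2 (inter_subset_left : Ω ∩ f ⁻¹' Ioo a b ⊆ Ω), inter_comm,
    ← Measure.restrict_restrict hms, ← lintegral_indicator hms]
  refine setLIntegral_congr_fun hΩo.measurableSet fun x hx => ?_
  rw [tr5_grad hf a b hab x hx]
  by_cases h : x ∈ f ⁻¹' Ioo a b
  · rw [indicator_of_mem h, indicator_of_mem (mem_inter hx h)]
  · have h3 : x ∉ Ω ∩ f ⁻¹' Ioo a (b) := fun h' => h h'.2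
    rw [indicator_of_notMem h, indicator_of_notMem h3, ENNReal.ofReal_zero]

/-- upgrade from bounded functions to all functions -/
lemma upgrade5 {n : ℕ} {Ω : Set (Euc n)} (hΩo : IsOpen Ω) (hΩ1 : volume Ω = 1)
    (p : ℝ) (C : ℝ) (hC : 0 ≤ C)
    (H : ∀ f : Euc n → ℝ, MemW Ω f → (∃ M, ∀ x, |f x| ≤ M) →
      eLpNorm (fun x => f x - ∫ y in Ω, f y) (ENNReal.ofReal p) (volume.restrict Ω) ≤
        ENNReal.ofReal (C * ∫ x in Ω, gradNorm f x))
    (f : Euc n → ℝ) (hf : MemW Ω f) :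
    eLpNorm (fun x => f x - ∫ y in Ω, f y) (ENNReal.ofReal p) (volume.restrict Ω) ≤
        ENNReal.ofReal (C * ∫ x in Ω, gradNorm f x) := by
  set g : ℕ → Euc n → ℝ := fun k x => tr5 (-((k : ℝ) + 1)) ((k : ℝ) + 1) (f x) with hg
  have hlt : ∀ k : ℕ, -((k : ℝ) + 1) < (k : ℝ) + 1 := fun k => by
    have : (0 : ℝ) ≤ k := k.cast_nonneg
    linarith
  have hW : ∀ k, MemW Ω (g k) := fun k => tr5_memW hΩo hΩ1 hf _ _ (hlt k)
  have hev : ∀ x, ∀ᶠ k in Filter.atTop, g k x = f x := by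
    intro x
    obtain ⟨N, hN⟩ := exists_nat_gt |f x|
    filter_upwards [Filter.eventually_ge_atTop N] with k hk
    have hk' : (N : ℝ) ≤ k := by exact_mod_cast hk
    have h1 := abs_lt.1 hN
    simp only [hg, tr5]
    rw [min_eq_left (by linarith [h1.2]), max_eq_right (by linarith [h1.1])]
  have hlim : ∀ x, Filter.Tendsto (fun k => g k x) Filter.atTop (nhds (f x)) := fun x =>
    tendsto_const_nhds.congr' ((hev x).mono fun k hk => hk.symm)
  have hbd : ∀ k x, |g k x| ≤ |f x| := by
    intro k x
    have hk : (0 : ℝ) ≤ k := k.cast_nonneg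
    have h0 : tr5 (-((k : ℝ) + 1)) ((k : ℝ) + 1) 0 = 0 := by
      unfold tr5
      rw [min_eq_left (by linarith), max_eq_right (by linarith)]
    have := (tr5_lip (-((k : ℝ) + 1)) ((k : ℝ) + 1)).dist_le_mul (f x) 0
    rw [h0] at this
    rw [Real.dist_eq, Real.dist_eq, sub_zero, sub_zero, NNReal.coe_one, one_mul] at this
    exact this
  have hmean : Filter.Tendsto (fun k => ∫ y in Ω, g k y) Filter.atTop (nhds (∫ y in Ω, f y)) := by
    refine tendsto_integral_of_dominated_convergence (fun x => |f x|) (fun k => (hW k).2.1.1)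
      hf.2.1.abs (fun k => Filter.Eventually.of_forall fun x => by simpa using hbd k x)
      (Filter.Eventually.of_forall hlim)
  refine (Lp.eLpNorm_lim_le_liminf_eLpNorm (f := fun k x => g k x - ∫ y in Ω, g k y)
    (fun k => (hW k).2.1.1.sub aestronglyMeasurable_const) _
    (Filter.Eventually.of_forall fun x => (hlim x).sub hmean)).trans ?_
  refine Filter.liminf_le_of_le (by isBoundedDefault) fun b hb => ?_
  obtain ⟨k, hk⟩ := hb.exists
  refine hk.trans ((H (g k) (hW k) ⟨_, fun x => tr5_bd _ _ _⟩).trans ?_)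
  refine ENNReal.ofReal_le_ofReal ?_
  exact mul_le_mul_of_nonneg_left (tr5_int_le hΩo hΩ1 hf _ _ (hlt k)) hC

/-- level-set estimate -/
lemma level5 {n : ℕ} {Ω : Set (Euc n)} (hΩo : IsOpen Ω) (hΩ1 : volume Ω = 1)
    (p : ℝ) (hp1 : 1 ≤ p) (C : ℝ) (hC : 0 ≤ C)
    (H : ∀ f : Euc n → ℝ, MemW Ω f →
      eLpNorm (fun x => f x - ∫ y in Ω, f y) (ENNReal.ofReal p) (volume.restrict Ω) ≤
        ENNReal.ofReal (C * ∫ x in Ω, gradNorm f x))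
    (f : Euc n → ℝ) (hf : MemW Ω f) (a h : ℝ) (hh : 0 < h) (m : ℝ≥0∞)
    (h1 : m ≤ volume.restrict Ω {x | f x ≤ a}) (h2 : m ≤ volume.restrict Ω {x | a + h ≤ f x}) :
    ENNReal.ofReal h * m ^ (1 / p) ≤
      ENNReal.ofReal (2 * C) * ∫⁻ x in Ω ∩ f ⁻¹' Ioo a (a + h), ENNReal.ofReal (gradNorm f x) := by
  have hab : a < a + h := by linarith
  have hp0 : 0 < p := by linarith
  have hW := tr5_memW hΩo hΩ1 hf a (a + h) hab
  have key := H _ hW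
  set c := ∫ y in Ω, tr5 a (a + h) (f y) with hc
  rw [ENNReal.ofReal_mul hC, tr5_int_eq hΩo hΩ1 hf a (a + h) hab] at key
  have hmeas : AEStronglyMeasurable (fun x => tr5 a (a + h) (f x) - c) (volume.restrict Ω) :=
    hW.2.1.1.sub aestronglyMeasurable_const
  have main : ENNReal.ofReal (h / 2) * m ^ (1 / p) ≤
      eLpNorm (fun x => tr5 a (a + h) (f x) - c) (ENNReal.ofReal p) (volume.restrict Ω) := by
    rcases le_total c (a + h / 2) with hcm | hcm
    · refine le_trans ?_ (cheb5 _ p hp1 _ hmeas (h / 2) {x | a + h ≤ f x} ?_)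
      · gcongr
      · intro x hx
        simp only [mem_ofPred_eq] at hx
        unfold tr5
        rw [min_eq_right hx, max_eq_right hab.le]
        refine le_trans ?_ (le_abs_self _)
        linarith
    · refine le_trans ?_ (cheb5 _ p hp1 _ hmeas (h / 2) {x | f x ≤ a} ?_)
      · gcongr
      · intro x hx
        simp only [mem_ofPred_eq] at hx
        unfold tr5
        rw [min_eq_left (by linarith), max_eq_left hx]
        refine le_trans ?_ (neg_le_abs _)
        linarith
  have e : ENNReal.ofReal h = 2 * ENNReal.ofReal (h / 2) := by
    rw [show (2 : ℝ≥0∞) = ENNReal.ofReal 2 by simp, ← ENNReal.ofReal_mul (by norm_num)]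
    congr 1; ring
  rw [e, mul_assoc, ENNReal.ofReal_mul (by norm_num : (0 : ℝ) ≤ 2), mul_assoc,
    show ENNReal.ofReal 2 = 2 by simp]
  exact mul_le_mul_right (main.trans key) 2

lemma level5' {n : ℕ} {Ω : Set (Euc n)} (hΩo : IsOpen Ω) (hΩ1 : volume Ω = 1)
    (p : ℝ) (hp1 : 1 ≤ p) (C : ℝ) (hC : 0 ≤ C)
    (H : ∀ f : Euc n → ℝ, MemW Ω f →
      eLpNorm (fun x => f x - ∫ y in Ω, f y) (ENNReal.ofReal p) (volume.restrict Ω) ≤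
        ENNReal.ofReal (C * ∫ x in Ω, gradNorm f x))
    (f : Euc n → ℝ) (hf : MemW Ω f) (a h : ℝ) (hh : 0 < h) (q : ℝ≥0∞)
    (h1 : 2⁻¹ * q ≤ volume.restrict Ω {x | f x ≤ a})
    (h2 : 2⁻¹ * q ≤ volume.restrict Ω {x | a + h ≤ f x}) :
    ENNReal.ofReal h * q ^ (1 / p) ≤
      ENNReal.ofReal (4 * C) * ∫⁻ x in Ω ∩ f ⁻¹' Ioo a (a + h), ENNReal.ofReal (gradNorm f x) := by
  have hp0 : 0 < p := by linarith
  have key := level5 hΩo hΩ1 p hp1 C hC H f hf a h hh _ h1 h2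
  have hq : q ^ (1 / p) ≤ 2 * (2⁻¹ * q) ^ (1 / p) := by
    have e : q = 2 * (2⁻¹ * q) := by
      rw [← mul_assoc, ENNReal.mul_inv_cancel (by norm_num) (by norm_num), one_mul]
    have h21 : (2 : ℝ≥0∞) ^ (1 / p) ≤ 2 := by
      calc (2 : ℝ≥0∞) ^ (1 / p) ≤ 2 ^ (1 : ℝ) :=
            ENNReal.rpow_le_rpow_of_exponent_le (by norm_num) (by rw [div_le_one hp0]; exact hp1)
        _ = 2 := by simp
    calc q ^ (1 / p) = (2 * (2⁻¹ * q)) ^ (1 / p) := by rw [← e]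
      _ = 2 ^ (1 / p) * (2⁻¹ * q) ^ (1 / p) := ENNReal.mul_rpow_of_nonneg _ _ (by positivity)
      _ ≤ _ := by gcongr
  calc ENNReal.ofReal h * q ^ (1 / p) ≤ ENNReal.ofReal h * (2 * (2⁻¹ * q) ^ (1 / p)) := by gcongr
    _ = 2 * (ENNReal.ofReal h * (2⁻¹ * q) ^ (1 / p)) := by ring
    _ ≤ 2 * (ENNReal.ofReal (2 * C) * ∫⁻ x in Ω ∩ f ⁻¹' Ioo a (a + h), ENNReal.ofReal (gradNorm f x)) := by
        gcongr
    _ = _ := by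
        rw [← mul_assoc, show (4 : ℝ) * C = 2 * (2 * C) by ring,
          ENNReal.ofReal_mul (by norm_num : (0 : ℝ) ≤ 2) (q := 2 * C), show ENNReal.ofReal 2 = 2 by simp]

lemma sum5 {n : ℕ} {Ω : Set (Euc n)} (hΩo : IsOpen Ω) (f : Euc n → ℝ) (hf : MemW Ω f)
    (h : ℝ) (s : ℕ → ℝ) (hs : ∀ i j, i < j → s i + h ≤ s j ∨ s j + h ≤ s i) :
    ∑' k, ∫⁻ x in Ω ∩ f ⁻¹' Ioo (s k) (s k + h), ENNReal.ofReal (gradNorm f x) ≤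
      ENNReal.ofReal (∫ x in Ω, gradNorm f x) := by
  have hcont : ContinuousOn f Ω := fun x hx => (contAt5 hf x hx).continuousWithinAt
  rw [← lintegral_iUnion
    (fun k => (hcont.isOpen_inter_preimage hΩo isOpen_Ioo).measurableSet),
    ofReal_integral_eq_lintegral_ofReal hf.2.2
      (Filter.Eventually.of_forall fun x => gradNorm_nonneg5 _ _)]
  · exact lintegral_mono_set (iUnion_subset fun k => inter_subset_left)
  · have hlt : ∀ i j, i < j → Disjoint (Ω ∩ f ⁻¹' Ioo (s i) (s i + h))
        (Ω ∩ f ⁻¹' Ioo (s j) (s j + h)) := by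
      intro i j hij
      rw [Set.disjoint_left]
      rintro x ⟨_, hx1, hx2⟩ ⟨_, hy1, hy2⟩
      rcases hs i j hij with h' | h' <;> linarith
    intro i j hij
    rcases lt_or_gt_of_ne hij with h' | h'
    · exact hlt i j h'
    · exact (hlt j i h').symm

lemma forward5 {n : ℕ} {Ω : Set (Euc n)} (hΩo : IsOpen Ω) (hΩ1 : volume Ω = 1)
    (p : ℝ) (hp1 : 1 ≤ p) (C : ℝ) (hC : 0 ≤ C)
    (H : ∀ f : Euc n → ℝ, MemW Ω f →
      eLpNorm (fun x => f x - ∫ y in Ω, f y) (ENNReal.ofReal p) (volume.restrict Ω) ≤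
        ENNReal.ofReal (C * ∫ x in Ω, gradNorm f x))
    (f : Euc n → ℝ) (hf : MemW Ω f) (h : ℝ) (hh : 0 < h) :
    ∫⁻ t in Ioc (0 : ℝ) 1, ENNReal.ofReal (t ^ (1 / p - 1) *
      decRearr (volume.restrict Ω) (fun x => f x - ∫ y in Ω, f y) t) ≤
      ENNReal.ofReal (p * (10 * C * (∫ x in Ω, gradNorm f x) + 2 * h)) := by
  have hp0 : 0 < p := by linarith
  set μ := volume.restrict Ω with hμ
  have : IsProbabilityMeasure μ := ⟨by simpa [hμ] using hΩ1⟩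
  set c := ∫ y in Ω, f y with hc
  set G := ∫ x in Ω, gradNorm f x with hG
  have hG0 : 0 ≤ G := integral_nonneg fun x => gradNorm_nonneg5 _ _
  have hCG : 0 ≤ C * G := mul_nonneg hC hG0
  set L := 2 * (C * G) + h with hL
  have hL0 : 0 < L := by linarith
  have hum : AEStronglyMeasurable (fun x => f x - c) μ := hf.2.1.1.sub aestronglyMeasurable_const
  set E := {x | L ≤ |f x - c|} with hE
  have hEhalf : μ E ≤ 2⁻¹ := by
    have h1 := (cheb5 μ p hp1 _ hum L E (fun x hx => hx)).trans (H f hf)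
    have h2 : μ E ≤ μ E ^ (1 / p) := by
      calc μ E = μ E ^ (1 : ℝ) := by simp
        _ ≤ _ := ENNReal.rpow_le_rpow_of_exponent_ge prob_le_one
          (by rw [div_le_one hp0]; exact hp1)
    have h3 : ENNReal.ofReal L * μ E ≤ ENNReal.ofReal L * 2⁻¹ := by
      calc ENNReal.ofReal L * μ E ≤ ENNReal.ofReal L * μ E ^ (1 / p) := by gcongr
        _ ≤ ENNReal.ofReal (C * G) := h1
        _ ≤ ENNReal.ofReal (L * 2⁻¹) := ENNReal.ofReal_le_ofReal (by linarith)
        _ = _ := by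
          rw [ENNReal.ofReal_mul hL0.le, ENNReal.ofReal_inv_of_pos (by norm_num)]
          simp
    exact (ENNReal.mul_le_mul_iff_right (by simpa using hL0) ENNReal.ofReal_ne_top).1 h3
  have hcompl : ∀ S : Set (Euc n), Eᶜ ⊆ S → 2⁻¹ ≤ μ S := by
    intro S hS
    have h1 : (1 : ℝ≥0∞) ≤ μ S + 2⁻¹ := by
      calc (1 : ℝ≥0∞) = μ univ := by simp
        _ ≤ μ (S ∪ E) := by
            apply measure_mono
            intro x _
            by_cases hx : x ∈ E
            · exact Or.inr hx
            · exact Or.inl (hS hx)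
        _ ≤ μ S + μ E := measure_union_le _ _
        _ ≤ _ := by gcongr
    have h2 : (1 : ℝ≥0∞) - 2⁻¹ ≤ μ S := tsub_le_iff_right.2 h1
    rwa [ENNReal.one_sub_inv_two] at h2
  have hq1 : ∀ S : Set (Euc n), 2⁻¹ * μ S ≤ 2⁻¹ := fun S => mul_le_of_le_one_right' prob_le_one
  have hq2 : ∀ S : Set (Euc n), 2⁻¹ * μ S ≤ μ S := fun S => mul_le_of_le_one_left' (by simp)
  have hterm : ∀ k : ℕ, ENNReal.ofReal h * μ {x | (L + h) + k * h < |f x - c|} ^ (1 / p) ≤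
      ENNReal.ofReal (4 * C) * (∫⁻ x in Ω ∩ f ⁻¹' Ioo (c + L + k * h) (c + L + k * h + h), ENNReal.ofReal (gradNorm f x))
      + ENNReal.ofReal (4 * C) * (∫⁻ x in Ω ∩ f ⁻¹' Ioo (c - L - h - k * h) (c - L - h - k * h + h), ENNReal.ofReal (gradNorm f x)) := by
    intro k
    have hkh : 0 ≤ (k : ℝ) * h := by positivity
    have hs : μ {x | (L + h) + k * h < |f x - c|} ≤ μ {x | c + L + k * h + h ≤ f x} +
        μ {x | f x ≤ c - L - h - k * h} := by
      refine (measure_mono ?_).trans (measure_union_le _ _)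
      intro x hx
      simp only [mem_ofPred_eq] at hx
      rcases lt_abs.1 hx with h' | h'
      · left
        simp only [mem_ofPred_eq]
        linarith
      · right
        simp only [mem_ofPred_eq]
        linarith
    have hA := level5' hΩo hΩ1 p hp1 C hC H f hf (c + L + k * h) h hh
      (μ {x | c + L + k * h + h ≤ f x}) ((hq1 _).trans (hcompl _ ?_)) (hq2 _)
    have hB := level5' hΩo hΩ1 p hp1 C hC H f hf (c - L - h - k * h) h hh
      (μ {x | f x ≤ c - L - h - k * h}) (hq2 _) ((hq1 _).trans (hcompl _ ?_))
    · calc _ ≤ ENNReal.ofReal h * (μ {x | c + L + k * h + h ≤ f x} +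
            μ {x | f x ≤ c - L - h - k * h}) ^ (1 / p) := by gcongr
        _ ≤ ENNReal.ofReal h * (μ {x | c + L + k * h + h ≤ f x} ^ (1 / p) +
            μ {x | f x ≤ c - L - h - k * h} ^ (1 / p)) := by
            gcongr
            exact ENNReal.rpow_add_le_add_rpow _ _ (by positivity)
              (by rw [div_le_one hp0]; exact hp1)
        _ ≤ _ := by
            rw [mul_add]
            exact add_le_add hA hB
    · intro x hx
      simp only [hE, mem_compl_iff, mem_ofPred_eq, not_le] at hx ⊢
      have := abs_lt.1 hx
      linarith [this.1]
    · intro x hx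
      simp only [hE, mem_compl_iff, mem_ofPred_eq, not_le] at hx ⊢
      have := abs_lt.1 hx
      linarith [this.2]
  have hsum : ENNReal.ofReal h * ∑' k : ℕ, μ {x | (L + h) + k * h < |f x - c|} ^ (1 / p) ≤
      ENNReal.ofReal (8 * C * G) := by
    rw [← ENNReal.tsum_mul_left]
    refine (ENNReal.tsum_le_tsum hterm).trans ?_
    rw [ENNReal.tsum_add, ENNReal.tsum_mul_left, ENNReal.tsum_mul_left]
    have s1 := sum5 hΩo f hf h (fun k => c + L + k * h) (by
      intro i j hij
      left
      have : (i : ℝ) + 1 ≤ j := by exact_mod_cast hij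
      nlinarith)
    have s2 := sum5 hΩo f hf h (fun k => c - L - h - k * h) (by
      intro i j hij
      right
      have : (i : ℝ) + 1 ≤ j := by exact_mod_cast hij
      nlinarith)
    refine (add_le_add (mul_le_mul_right s1 _) (mul_le_mul_right s2 _)).trans ?_
    rw [← ENNReal.ofReal_mul (by positivity), ← ENNReal.ofReal_add (by nlinarith) (by nlinarith)]
    exact ENNReal.ofReal_le_ofReal (by linarith)
  refine (upper5 μ p hp1 (fun x => f x - c) hum (L + h) h (by linarith) hh).trans ?_
  rw [ENNReal.ofReal_mul hp0.le]
  gcongr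
  refine (add_le_add_right hsum _).trans ?_
  rw [← ENNReal.ofReal_add (by linarith) (by nlinarith)]
  exact ENNReal.ofReal_le_ofReal (by linarith)

/-- For `1 ≤ p ≤ n/(n−1)`, the `p`-Sobolev–Poincaré inequality on `Ω` is
equivalent to the Lorentz `L^{p,1}` Sobolev–Poincaré inequality
`‖f − f_Ω‖_{L^{p,1}(Ω)} = ∫₀¹ t^{1/p−1}(f − f_Ω)*(t) dt ≤ C₁ ∫_Ω |∇f|`. -/
theorem stmt5 (n : ℕ) (hn : 2 ≤ n) (Ω : Set (Euc n)) (hΩo : IsOpen Ω)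
    (hΩc : IsConnected Ω) (hΩ1 : volume Ω = 1)
    (p : ℝ) (hp1 : 1 ≤ p) (hp2 : p ≤ (n : ℝ) / ((n : ℝ) - 1)) :
    (∃ C₀ : ℝ, 0 < C₀ ∧ SPIneq Ω p C₀) ↔
      (∃ C₁ : ℝ, 0 < C₁ ∧ ∀ f : Euc n → ℝ, MemW Ω f →
        (∫ t in Ioc (0 : ℝ) 1,
            t ^ (1 / p - 1) *
              decRearr (volume.restrict Ω) (fun x => f x - ∫ y in Ω, f y) t)
          ≤ C₁ * ∫ x in Ω, gradNorm f x) := by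
  have hp0 : 0 < p := by linarith
  have : IsProbabilityMeasure (volume.restrict Ω) := ⟨by simpa using hΩ1⟩
  have hGn : ∀ f : Euc n → ℝ, 0 ≤ ∫ x in Ω, gradNorm f x := fun f =>
    integral_nonneg fun x => gradNorm_nonneg5 _ _
  have hpne : ENNReal.ofReal p ≠ 0 := by simpa using hp0
  constructor
  · rintro ⟨C, hC, hS⟩
    have H := upgrade5 hΩo hΩ1 p C hC.le (by
      rintro f hf ⟨M, hM⟩
      have hmem : MemLp (fun x => f x - ∫ y in Ω, f y) (ENNReal.ofReal p) (volume.restrict Ω) := by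
        refine MemLp.of_bound (hf.2.1.1.sub aestronglyMeasurable_const) (M + |∫ y in Ω, f y|) ?_
        refine Filter.Eventually.of_forall fun x => ?_
        refine (norm_sub_le _ _).trans ?_
        exact add_le_add (hM x) le_rfl
      rw [hmem.eLpNorm_eq_integral_rpow_norm hpne ENNReal.ofReal_ne_top,
        ENNReal.toReal_ofReal hp0.le, ← one_div]
      exact ENNReal.ofReal_le_ofReal (hS f hf))
    refine ⟨10 * p * C, by positivity, fun f hf => ?_⟩
    refine le_of_forall_pos_le_add fun ε hε => ?_
    have h1 := forward5 hΩo hΩ1 p hp1 C hC.le H f hf (ε / (2 * p)) (by positivity)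
    have hnn : ∀ᵐ t : ℝ ∂(volume.restrict (Ioc (0 : ℝ) 1)),
        ENNReal.ofReal ‖t ^ (1 / p - 1) *
          decRearr (volume.restrict Ω) (fun x => f x - ∫ y in Ω, f y) t‖ =
        ENNReal.ofReal (t ^ (1 / p - 1) *
          decRearr (volume.restrict Ω) (fun x => f x - ∫ y in Ω, f y) t) := by
      filter_upwards [ae_restrict_mem measurableSet_Ioc] with t ht
      rw [Real.norm_of_nonneg (mul_nonneg (Real.rpow_nonneg ht.1.le _) (decRearr_nonneg5 _ _ _))]
    refine (Real.le_norm_self _).trans ((norm_integral_le_lintegral_norm _).trans ?_)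
    rw [lintegral_congr_ae hnn]
    refine (ENNReal.toReal_mono ENNReal.ofReal_ne_top h1).trans ?_
    have := hGn f
    rw [ENNReal.toReal_ofReal (by positivity)]
    apply le_of_eq
    field_simp
  · rintro ⟨C, hC, hS⟩
    have H := upgrade5 hΩo hΩ1 p C hC.le (by
      rintro f hf ⟨M, hM⟩
      have hM0 : 0 ≤ M := (abs_nonneg _).trans (hM 0)
      refine (lower5 (volume.restrict Ω) p hp1 (fun x => f x - ∫ y in Ω, f y)
        (hf.2.1.1.sub aestronglyMeasurable_const) (M + |∫ y in Ω, f y|) (by positivity) ?_).trans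
        (ENNReal.ofReal_le_ofReal (hS f hf))
      intro x
      refine (abs_sub _ _).trans ?_
      exact add_le_add (hM x) le_rfl)
    refine ⟨C, hC, fun f hf => ?_⟩
    have hmem : MemLp (fun x => f x - ∫ y in Ω, f y) (ENNReal.ofReal p) (volume.restrict Ω) :=
      ⟨hf.2.1.1.sub aestronglyMeasurable_const, (H f hf).trans_lt ENNReal.ofReal_lt_top⟩
    have h1 := H f hf
    rw [hmem.eLpNorm_eq_integral_rpow_norm hpne ENNReal.ofReal_ne_top,
        ENNReal.toReal_ofReal hp0.le, ← one_div] at h1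
    exact (ENNReal.ofReal_le_ofReal_iff (mul_nonneg hC.le (hGn f))).1 h1
end
end
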